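/- Let K be a convex body in ℝ^n with rB^n ⊂ int K for some r > 0, let ω ⊂ S^{n-1} be a closed set, and for t ∈ (0, r) let K_t = {x ∈ K : ⟨x, v⟩ ≤ h_K(v) − t for every v ∈ ω}, with support function h_t. Then for every u ∈ S^{n-1}, the limit lim_{t→0^+} (h_t(u) − h_K(u))/t exists (and is ≤ −1 for u ∈ ω). -/

import Mathlib

open MeasureTheory Metric Set Filter
open scoped ENNReal RealInnerProductSpace NNReal

noncomputable section

abbrev Eu (n : ℕ) : Type := EuclideanSpace ℝ (Fin n)

def IsConvexBody {n : ℕ} (K : Set (Eu n)) : Prop :=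
  Convex ℝ K ∧ IsCompact K ∧ (interior K).Nonempty

def suppFn {n : ℕ} (K : Set (Eu n)) (u : Eu n) : ℝ :=
  sSup ((fun x => ⟪x, u⟫) '' K)

def IsOuterNormal {n : ℕ} (K : Set (Eu n)) (x u : Eu n) : Prop :=
  ‖u‖ = 1 ∧ ∀ y ∈ K, ⟪y, u⟫ ≤ ⟪x, u⟫

def gaussMap {n : ℕ} (K : Set (Eu n)) (x : Eu n) : Eu n :=
  open scoped Classical in
  if h : ∃ u, IsOuterNormal K x u then h.choose else 0

def lpSurf {n : ℕ} (p : ℝ) (K : Set (Eu n)) (ω : Set (Eu n)) : ℝ≥0∞ :=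
  ∫⁻ x in {x ∈ frontier K | gaussMap K x ∈ ω},
    ENNReal.ofReal (⟪x, gaussMap K x⟫ ^ (1 - p)) ∂(μH[(n:ℝ) - 1])

lemma bddAbove_inner_image {n : ℕ} {K : Set (Eu n)} (hK : IsCompact K) (u : Eu n) :
    BddAbove ((fun x => ⟪x, u⟫) '' K) :=
  hK.bddAbove_image (by fun_prop)

lemma inner_le_suppFn {n : ℕ} {K : Set (Eu n)} (hK : IsCompact K) (u : Eu n) {x : Eu n}
    (hx : x ∈ K) : ⟪x, u⟫ ≤ suppFn K u :=
  le_csSup (bddAbove_inner_image hK u) (mem_image_of_mem _ hx)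

lemma suppFn_le {n : ℕ} {K : Set (Eu n)} (hK : K.Nonempty) {u : Eu n} {a : ℝ}
    (h : ∀ x ∈ K, ⟪x, u⟫ ≤ a) : suppFn K u ≤ a :=
  csSup_le (hK.image _) (forall_mem_image.2 h)

/-- The set obtained from `K` by moving its supporting halfspaces with normals in `ω` inwards
by `t`. -/
def inwardWulff {n : ℕ} (K ω : Set (Eu n)) (t : ℝ) : Set (Eu n) :=
  {x ∈ K | ∀ v ∈ ω, ⟪x, v⟫ ≤ suppFn K v - t}

lemma zero_mem_inwardWulff {n : ℕ} {K ω : Set (Eu n)} (hK : IsCompact K) {r t : ℝ}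
    (hr : 0 ≤ r) (hrK : closedBall (0 : Eu n) r ⊆ K) (hω : ω ⊆ sphere (0 : Eu n) 1)
    (ht : t ≤ r) : (0 : Eu n) ∈ inwardWulff K ω t := by
  refine ⟨hrK (by simpa using hr), fun v hv => ?_⟩
  have hv1 : ‖v‖ = 1 := by simpa using hω hv
  have hrv : r • v ∈ K := hrK (by simp [norm_smul, hv1, abs_of_nonneg hr])
  have h := inner_le_suppFn hK v hrv
  rw [real_inner_smul_left, real_inner_self_eq_norm_sq, hv1] at h
  rw [inner_zero_left]
  linarith

lemma combo_mem_inwardWulff {n : ℕ} {K ω : Set (Eu n)} (hconv : Convex ℝ K)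
    (hK : IsCompact K) {t c : ℝ} (hc0 : 0 ≤ c) (hc1 : c ≤ 1) {x y : Eu n}
    (hx : x ∈ inwardWulff K ω t) (hy : y ∈ K) :
    c • x + (1 - c) • y ∈ inwardWulff K ω (c * t) := by
  refine ⟨hconv hx.1 hy hc0 (by linarith) (by ring), fun v hv => ?_⟩
  have h1 := mul_le_mul_of_nonneg_left (hx.2 v hv) hc0
  have h2 := mul_le_mul_of_nonneg_left (inner_le_suppFn hK v hy) (sub_nonneg.2 hc1)
  rw [inner_add_left, real_inner_smul_left, real_inner_smul_left]
  linarith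

lemma combo_suppFn_le_suppFn_inwardWulff {n : ℕ} {K ω : Set (Eu n)} (hconv : Convex ℝ K)
    (hK : IsCompact K) {t c : ℝ} (hc0 : 0 < c) (hc1 : c < 1)
    (hne : (inwardWulff K ω t).Nonempty) (u : Eu n) :
    c * suppFn (inwardWulff K ω t) u + (1 - c) * suppFn K u ≤
      suppFn (inwardWulff K ω (c * t)) u := by
  have hc1' : 0 < 1 - c := sub_pos.2 hc1
  have hbdd : BddAbove ((fun x => ⟪x, u⟫) '' inwardWulff K ω (c * t)) :=
    (bddAbove_inner_image hK u).mono (image_mono (sep_subset _ _))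
  have h1 : ∀ x ∈ inwardWulff K ω t,
      suppFn K u ≤ (suppFn (inwardWulff K ω (c * t)) u - c * ⟪x, u⟫) / (1 - c) := by
    refine fun x hx => suppFn_le (hne.mono (sep_subset _ _)) fun y hy => ?_
    have h := le_csSup hbdd
      (mem_image_of_mem _ (combo_mem_inwardWulff hconv hK hc0.le hc1.le hx hy))
    simp only [inner_add_left, real_inner_smul_left] at h
    rw [le_div_iff₀ hc1', suppFn]
    linarith
  have h2 : suppFn (inwardWulff K ω t) u ≤
      (suppFn (inwardWulff K ω (c * t)) u - (1 - c) * suppFn K u) / c := by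
    refine suppFn_le hne fun x hx => ?_
    have h := h1 x hx
    rw [le_div_iff₀ hc1'] at h
    rw [le_div_iff₀ hc0]
    linarith
  rw [le_div_iff₀ hc0] at h2
  linarith

lemma antitoneOn_suppFn_inwardWulff_quotient {n : ℕ} {K ω : Set (Eu n)}
    (hconv : Convex ℝ K) (hK : IsCompact K) {r : ℝ}
    (hne : ∀ t < r, (inwardWulff K ω t).Nonempty) (u : Eu n) :
    AntitoneOn (fun t : ℝ => (suppFn (inwardWulff K ω t) u - suppFn K u) / t) (Ioo 0 r) := by
  intro s hs t ht hst
  rcases hst.eq_or_lt with rfl | hst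
  · exact le_rfl
  have ht0 := ht.1
  have hs0 := hs.1
  have h := combo_suppFn_le_suppFn_inwardWulff hconv hK (div_pos hs0 ht0)
    ((div_lt_one ht0).2 hst) (hne t ht.2) u
  rw [div_mul_cancel₀ _ ht0.ne'] at h
  have e : s / t * (suppFn (inwardWulff K ω t) u - suppFn K u) ≤
      suppFn (inwardWulff K ω s) u - suppFn K u := by linarith
  change _ / t ≤ _ / s
  rw [le_div_iff₀ hs0]
  calc _ = _ := by ring
    _ ≤ _ := e

/-- Lemma 5.1: for a convex body `K` with `rBⁿ ⊆ int K`, a closed set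
`ω ⊆ S^{n-1}` and `K_t = {x ∈ K : ⟨x,v⟩ ≤ h_K(v) - t ∀ v ∈ ω}`, the limit
`lim_{t→0⁺} (h_t(u) - h_K(u))/t` exists for every `u ∈ S^{n-1}`, and is `≤ -1` for
`u ∈ ω`. -/
theorem inward_wulff_variation
    (n : ℕ) (K : Set (Eu n)) (hK : IsConvexBody K)
    (r : ℝ) (hr : 0 < r) (hrK : closedBall (0 : Eu n) r ⊆ interior K)
    (ω : Set (Eu n)) (hω : IsClosed ω) (hωs : ω ⊆ sphere (0 : Eu n) 1)
    (Kt : ℝ → Set (Eu n))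
    (hKt : ∀ t, Kt t = {x ∈ K | ∀ v ∈ ω, ⟪x, v⟫ ≤ suppFn K v - t}) :
    ∀ u ∈ sphere (0 : Eu n) 1, ∃ l : ℝ,
      Filter.Tendsto (fun t : ℝ => (suppFn (Kt t) u - suppFn K u) / t)
        (nhdsWithin 0 (Set.Ioi 0)) (nhds l) ∧ (u ∈ ω → l ≤ -1) := by
  intro u _
  obtain rfl : Kt = inwardWulff K ω := funext hKt
  obtain ⟨hconv, hcomp, -⟩ := hK
  have hne : ∀ t < r, (inwardWulff K ω t).Nonempty := fun t ht =>
    ⟨0, zero_mem_inwardWulff hcomp hr.le (hrK.trans interior_subset) hωs ht.le⟩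
  have hnonpos : ∀ t ∈ Ioo 0 r, (suppFn (inwardWulff K ω t) u - suppFn K u) / t ≤ 0 :=
    fun t ht => div_nonpos_of_nonpos_of_nonneg
      (sub_nonpos.2 (suppFn_le (hne t ht.2) fun x hx => inner_le_suppFn hcomp u hx.1)) ht.1.le
  have hlim := AntitoneOn.tendsto_nhdsWithin_Ioo_right (nonempty_Ioo.2 hr)
    (antitoneOn_suppFn_inwardWulff_quotient hconv hcomp hne u) ⟨0, forall_mem_image.2 hnonpos⟩
  refine ⟨_, hlim, fun hu => le_of_tendsto hlim ?_⟩
  filter_upwards [Ioo_mem_nhdsGT hr] with t ht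
  rw [div_le_iff₀ ht.1]
  linarith [suppFn_le (hne t ht.2) fun x hx => hx.2 u hu]

end
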